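/- arXiv:2410.22248 — 3 statements merged into one kernel-verified Lean document; each statement's English description precedes it below -/
import Mathlib

section
/- Let d ≥ 1, Θ ⊂ ℝ^d compact, and σ > 0. Then the family M_σ(Θ) = { φ_σ ∗ G : G ∈ P(Θ) } is compact in L¹(ℝ^d): every sequence p_n ∈ M_σ(Θ) has a subsequence converging in the L¹ norm to an element of M_σ(Θ). -/
open MeasureTheory Real Filter

noncomputable section

/-- Density of the multivariate Gaussian `N(0, σ² I_d)` on `ℝ^d`. -/
def gaussDensity (d : ℕ) (σ : ℝ) (x : EuclideanSpace ℝ (Fin d)) : ℝ :=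
  (2 * π * σ ^ 2) ^ (-(d : ℝ) / 2) * Real.exp (-‖x‖ ^ 2 / (2 * σ ^ 2))

/-- The mixture density `φ_σ ∗ G`. -/
def mixDensity (d : ℕ) (σ : ℝ) (G : Measure (EuclideanSpace ℝ (Fin d)))
    (x : EuclideanSpace ℝ (Fin d)) : ℝ :=
  ∫ θ, gaussDensity d σ (x - θ) ∂G

open scoped Topology BoundedContinuousFunction

lemma gaussDensity_nonneg (d : ℕ) (σ : ℝ) (x : EuclideanSpace ℝ (Fin d)) :
    0 ≤ gaussDensity d σ x := by
  unfold gaussDensity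
  positivity

lemma continuous_gaussDensity (d : ℕ) (σ : ℝ) : Continuous (gaussDensity d σ) := by
  unfold gaussDensity
  fun_prop

lemma gaussDensity_le (d : ℕ) (σ : ℝ) (x : EuclideanSpace ℝ (Fin d)) :
    gaussDensity d σ x ≤ (2 * π * σ ^ 2) ^ (-(d : ℝ) / 2) := by
  unfold gaussDensity
  refine mul_le_of_le_one_right (by positivity) (Real.exp_le_one_iff.2 ?_)
  exact div_nonpos_of_nonpos_of_nonneg (by simp) (by positivity)

/-- Translates of the Gaussian density by vectors of norm at most `R` are dominated by this
function. -/
def gaussEnvelope (d : ℕ) (σ R : ℝ) (x : EuclideanSpace ℝ (Fin d)) : ℝ :=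
  (2 * π * σ ^ 2) ^ (-(d : ℝ) / 2) *
    (Real.exp (R ^ 2 / (2 * σ ^ 2)) * Real.exp (-(1 / (4 * σ ^ 2)) * ‖x‖ ^ 2))

lemma gaussDensity_sub_le_gaussEnvelope (d : ℕ) {σ R : ℝ} (hσ : 0 < σ)
    {θ : EuclideanSpace ℝ (Fin d)} (hθ : ‖θ‖ ≤ R) (x : EuclideanSpace ℝ (Fin d)) :
    gaussDensity d σ (x - θ) ≤ gaussEnvelope d σ R x := by
  unfold gaussDensity gaussEnvelope
  rw [← Real.exp_add]
  gcongr
  have hx : ‖x‖ ≤ ‖x - θ‖ + R := by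
    linarith [norm_sub_norm_le x θ]
  have key : ‖x‖ ^ 2 / 2 - R ^ 2 ≤ ‖x - θ‖ ^ 2 := by
    have := pow_le_pow_left₀ (norm_nonneg x) hx 2
    nlinarith [sq_nonneg (‖x - θ‖ - R)]
  calc -‖x - θ‖ ^ 2 / (2 * σ ^ 2) ≤ (R ^ 2 - ‖x‖ ^ 2 / 2) / (2 * σ ^ 2) := by
        gcongr
        linarith
    _ = _ := by
        field_simp
        ring

lemma integrable_gaussEnvelope (d : ℕ) {σ : ℝ} (hσ : 0 < σ) (R : ℝ) :
    Integrable (gaussEnvelope d σ R) := by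
  unfold gaussEnvelope
  refine Integrable.const_mul (Integrable.const_mul ?_ _) _
  refine not_imp_comm.1 integral_undef ?_
  rw [GaussianFourier.integral_rexp_neg_mul_sq_norm (by positivity)]
  positivity

lemma continuous_mixDensity (d : ℕ) (σ : ℝ) (G : Measure (EuclideanSpace ℝ (Fin d)))
    [IsFiniteMeasure G] : Continuous (mixDensity d σ G) := by
  unfold mixDensity
  have hc := continuous_gaussDensity d σ
  refine continuous_of_dominated (bound := fun _ => (2 * π * σ ^ 2) ^ (-(d : ℝ) / 2))
    (fun x => ?_) (fun x => ?_) (integrable_const _) ?_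
  · exact (hc.comp (continuous_const.sub continuous_id)).aestronglyMeasurable
  · refine .of_forall fun θ => ?_
    rw [Real.norm_of_nonneg (gaussDensity_nonneg d σ _)]
    exact gaussDensity_le d σ _
  · exact .of_forall fun θ => hc.comp (continuous_id.sub continuous_const)

lemma abs_mixDensity_le_gaussEnvelope (d : ℕ) {σ R : ℝ} (hσ : 0 < σ)
    (G : Measure (EuclideanSpace ℝ (Fin d))) [IsProbabilityMeasure G]
    (hG : ∀ᵐ θ ∂G, ‖θ‖ ≤ R) (x : EuclideanSpace ℝ (Fin d)) :
    |mixDensity d σ G x| ≤ gaussEnvelope d σ R x := by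
  have h := norm_integral_le_of_norm_le_const (μ := G)
    (f := fun θ => gaussDensity d σ (x - θ)) (C := gaussEnvelope d σ R x) (by
      filter_upwards [hG] with θ hθ
      rw [Real.norm_of_nonneg (gaussDensity_nonneg d σ _)]
      exact gaussDensity_sub_le_gaussEnvelope d hσ hθ x)
  simpa [mixDensity] using h

lemma tendsto_mixDensity (d : ℕ) (σ : ℝ)
    {G : ℕ → ProbabilityMeasure (EuclideanSpace ℝ (Fin d))}
    {H : ProbabilityMeasure (EuclideanSpace ℝ (Fin d))} (hG : Tendsto G atTop (𝓝 H))
    (x : EuclideanSpace ℝ (Fin d)) :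
    Tendsto (fun n => mixDensity d σ (G n) x) atTop (𝓝 (mixDensity d σ H x)) := by
  let f : EuclideanSpace ℝ (Fin d) →ᵇ ℝ := BoundedContinuousFunction.ofNormedAddCommGroup
    (fun θ => gaussDensity d σ (x - θ))
    ((continuous_gaussDensity d σ).comp (continuous_const.sub continuous_id))
    ((2 * π * σ ^ 2) ^ (-(d : ℝ) / 2)) (fun θ => by
      rw [Real.norm_of_nonneg (gaussDensity_nonneg d σ _)]
      exact gaussDensity_le d σ _)
  exact ProbabilityMeasure.tendsto_iff_forall_integral_tendsto.1 hG f

/-- Weak convergence of uniformly boundedly supported mixing measures gives `L¹` convergence of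
the Gaussian mixture densities. -/
lemma tendsto_integral_abs_mixDensity_sub (d : ℕ) {σ R : ℝ} (hσ : 0 < σ)
    {G : ℕ → ProbabilityMeasure (EuclideanSpace ℝ (Fin d))}
    {H : ProbabilityMeasure (EuclideanSpace ℝ (Fin d))} (hG : Tendsto G atTop (𝓝 H))
    (hGR : ∀ n, ∀ᵐ θ ∂(G n : Measure (EuclideanSpace ℝ (Fin d))), ‖θ‖ ≤ R)
    (hHR : ∀ᵐ θ ∂(H : Measure (EuclideanSpace ℝ (Fin d))), ‖θ‖ ≤ R) :
    Tendsto (fun n => ∫ x, |mixDensity d σ (G n) x - mixDensity d σ H x|) atTop (𝓝 0) := by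
  rw [← integral_zero (EuclideanSpace ℝ (Fin d)) ℝ (μ := volume)]
  refine tendsto_integral_of_dominated_convergence
    (fun x => gaussEnvelope d σ R x + gaussEnvelope d σ R x) (fun n => ?_)
    ((integrable_gaussEnvelope d hσ R).add (integrable_gaussEnvelope d hσ R))
    (fun n => .of_forall fun x => ?_) (.of_forall fun x => ?_)
  · exact ((continuous_mixDensity d σ _).sub
      (continuous_mixDensity d σ _)).abs.aestronglyMeasurable
  · rw [Real.norm_eq_abs, abs_abs]
    exact (abs_sub _ _).trans (add_le_add
      (abs_mixDensity_le_gaussEnvelope d hσ _ (hGR n) x)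
      (abs_mixDensity_le_gaussEnvelope d hσ _ hHR x))
  · simpa using ((tendsto_mixDensity d σ hG x).sub_const (mixDensity d σ H x)).abs

/-- The probability measures carried by a compact subset of a Hausdorff normal space form a
compact set for the topology of weak convergence. -/
lemma isCompact_probabilityMeasure_compl_eq_zero {E : Type*} [MeasurableSpace E]
    [TopologicalSpace E] [T2Space E] [NormalSpace E] [BorelSpace E] {K : Set E}
    (hK : IsCompact K) : IsCompact {μ : ProbabilityMeasure E | (μ : Measure E) Kᶜ = 0} := by
  have h := isCompact_setOfPred_probabilityMeasure_mass_eq_compl_isCompact_le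
    (u := fun _ => 0) (K := fun _ => K) tendsto_const_nhds (fun _ => hK) (.inl inferInstance)
  convert h using 3 with μ
  simp [ProbabilityMeasure.null_iff_toMeasure_null]

/-- For compact `Θ ⊆ ℝ^d` and `σ > 0`, the family
`M_σ(Θ) = {φ_σ ∗ G : G ∈ P(Θ)}` is compact in `L¹(ℝ^d)`: every sequence in `M_σ(Θ)`
has a subsequence converging in `L¹` norm to an element of `M_σ(Θ)`. -/
theorem mixture_family_L1_compact
    (d : ℕ) (hd : 1 ≤ d)
    (Θ : Set (EuclideanSpace ℝ (Fin d))) (hΘc : IsCompact Θ)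
    (σ : ℝ) (hσ : 0 < σ)
    (G : ℕ → Measure (EuclideanSpace ℝ (Fin d)))
    (hGprob : ∀ n, IsProbabilityMeasure (G n)) (hGsupp : ∀ n, G n Θᶜ = 0) :
    ∃ (φ : ℕ → ℕ) (H : Measure (EuclideanSpace ℝ (Fin d))),
      StrictMono φ ∧ IsProbabilityMeasure H ∧ H Θᶜ = 0 ∧
        Tendsto (fun n => ∫ x, |mixDensity d σ (G (φ n)) x - mixDensity d σ H x|)
          atTop (nhds 0) := by
  obtain ⟨R, hR⟩ := hΘc.isBounded.exists_norm_le
  have bounded_of_compl_eq_zero {μ : Measure (EuclideanSpace ℝ (Fin d))} (hμ : μ Θᶜ = 0) :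
      ∀ᵐ θ ∂μ, ‖θ‖ ≤ R := by
    filter_upwards [show ∀ᵐ θ ∂μ, θ ∈ Θ from hμ] with θ hθ using hR θ hθ
  let P : ℕ → ProbabilityMeasure (EuclideanSpace ℝ (Fin d)) := fun n => ⟨G n, hGprob n⟩
  obtain ⟨H, hH, φ, hφ, hlim⟩ :=
    (isCompact_probabilityMeasure_compl_eq_zero hΘc).tendsto_subseq (x := P) hGsupp
  exact ⟨φ, H, hφ, inferInstance, hH, tendsto_integral_abs_mixDensity_sub d hσ hlim
    (fun n => bounded_of_compl_eq_zero (hGsupp (φ n))) (bounded_of_compl_eq_zero hH)⟩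

end
end

section
/- Let d = 1, let Y₁ ≤ ⋯ ≤ Y_n be real numbers with r = (Y_n − Y₁)/2, and suppose σ > r. Then the Dirac measure δ_{Ȳ} at the sample mean Ȳ = n^{-1}∑_{i=1}^n Y_i maximizes the log-likelihood G ↦ ∑_{i=1}^n log (φ_σ ∗ G)(Y_i) over P(ℝ); that is, for every G ∈ P(ℝ), ∑_{i=1}^n log (φ_σ ∗ G)(Y_i) ≤ ∑_{i=1}^n log φ_σ(Y_i − Ȳ). -/
open MeasureTheory Real

noncomputable section

/-- Density of the one-dimensional Gaussian `N(0, σ²)`. -/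
def gauss1 (σ : ℝ) (x : ℝ) : ℝ :=
  (Real.sqrt (2 * π * σ ^ 2))⁻¹ * Real.exp (-x ^ 2 / (2 * σ ^ 2))

/-- The one-dimensional mixture density `(φ_σ ∗ G)(y) = ∫ φ_σ(y - θ) dG(θ)`. -/
def mix1 (σ : ℝ) (G : Measure ℝ) (y : ℝ) : ℝ :=
  ∫ θ, gauss1 σ (y - θ) ∂G

/-- Hoeffding's lemma for the uniform distribution on finitely many centred points. -/
theorem sum_exp_mul_le_of_sum_eq_zero {n : ℕ} (hn : 1 ≤ n) {x : Fin n → ℝ} {a b : ℝ}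
    (hx : ∀ i, x i ∈ Set.Icc a b) (hsum : ∑ i, x i = 0) (s : ℝ) :
    ∑ i, Real.exp (s * x i) ≤ n * Real.exp (((b - a) / 2) ^ 2 * s ^ 2 / 2) := by
  have hn0 : (0 : ℝ) < n := by exact_mod_cast hn
  have hne : (n : ENNReal) ≠ 0 := by exact_mod_cast (by omega : n ≠ 0)
  let μ : Measure (Fin n) := (n : ENNReal)⁻¹ • Measure.count
  have hμ : IsProbabilityMeasure μ := ⟨by
    simp [μ, Measure.count_univ, ENNReal.inv_mul_cancel hne (ENNReal.natCast_ne_top n)]⟩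
  have hint (f : Fin n → ℝ) : ∫ i, f i ∂μ = (n : ℝ)⁻¹ * ∑ i, f i := by
    simp [μ, integral_smul_measure, integral_count]
  have hsub := ProbabilityTheory.hasSubgaussianMGF_of_mem_Icc_of_integral_eq_zero
    (μ := μ) (X := x) (a := a) (b := b) (measurable_of_finite x).aemeasurable
    (Filter.Eventually.of_forall hx) (by rw [hint, hsum, mul_zero])
  have h := hsub.mgf_le s
  rw [ProbabilityTheory.mgf, hint, inv_mul_le_iff₀ hn0] at h
  simpa [div_pow] using h

theorem gauss1_pos {σ : ℝ} (hσ : 0 < σ) (x : ℝ) : 0 < gauss1 σ x := by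
  unfold gauss1
  positivity

theorem integrable_gauss1_sub (σ y : ℝ) (G : Measure ℝ) [IsFiniteMeasure G] :
    Integrable (fun θ => gauss1 σ (y - θ)) G := by
  refine Integrable.of_bound (C := (Real.sqrt (2 * π * σ ^ 2))⁻¹) ?_ ?_
  · unfold gauss1
    exact (by fun_prop : Continuous fun θ : ℝ =>
      (Real.sqrt (2 * π * σ ^ 2))⁻¹ * Real.exp (-(y - θ) ^ 2 / (2 * σ ^ 2))).aestronglyMeasurable
  · refine Filter.Eventually.of_forall fun θ => ?_
    rw [gauss1, Real.norm_of_nonneg (by positivity)]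
    refine mul_le_of_le_one_right (by positivity) (Real.exp_le_one_iff.2 ?_)
    exact div_nonpos_of_nonpos_of_nonneg (by nlinarith [sq_nonneg (y - θ)]) (by positivity)

theorem mix1_pos {σ : ℝ} (hσ : 0 < σ) (y : ℝ) (G : Measure ℝ) [IsProbabilityMeasure G] :
    0 < mix1 σ G y := by
  rw [mix1, integral_pos_iff_support_of_nonneg (fun θ => (gauss1_pos hσ _).le)
    (integrable_gauss1_sub σ y G)]
  have : Function.support (fun θ => gauss1 σ (y - θ)) = Set.univ :=
    Set.eq_univ_of_forall fun θ => (gauss1_pos hσ _).ne'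
  simp [this]

theorem gauss1_sub_div_gauss1_sub {σ : ℝ} (hσ : 0 < σ) (y θ m : ℝ) :
    gauss1 σ (y - θ) / gauss1 σ (y - m) =
      Real.exp (-(θ - m) ^ 2 / (2 * σ ^ 2)) * Real.exp ((θ - m) / σ ^ 2 * (y - m)) := by
  unfold gauss1
  rw [mul_div_mul_left _ _ (by positivity), ← Real.exp_sub, ← Real.exp_add]
  congr 1
  field_simp
  ring

/-- The directional derivative of the likelihood at `δ_Ȳ` towards `δ_θ` is nonpositive. -/
theorem sum_gauss1_sub_div_le {σ : ℝ} (hσ : 0 < σ) {n : ℕ} (hn : 1 ≤ n) {Y : Fin n → ℝ}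
    {a b : ℝ} (hY : ∀ i, Y i ∈ Set.Icc a b) (hab : a ≤ b) (hσr : (b - a) / 2 ≤ σ) (θ : ℝ) :
    ∑ i, gauss1 σ (Y i - θ) / gauss1 σ (Y i - (∑ j, Y j) / n) ≤ n := by
  have hn0 : (0 : ℝ) < n := by exact_mod_cast hn
  set m := (∑ j, Y j) / n with hm
  have hsum : ∑ i, (Y i - m) = 0 := by
    simp [Finset.sum_sub_distrib, hm, mul_div_cancel₀ _ hn0.ne']
  have h := sum_exp_mul_le_of_sum_eq_zero hn (a := a - m) (b := b - m)
    (fun i => ⟨sub_le_sub_right (hY i).1 m, sub_le_sub_right (hY i).2 m⟩) hsum ((θ - m) / σ ^ 2)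
  simp_rw [gauss1_sub_div_gauss1_sub hσ, ← Finset.mul_sum]
  refine (mul_le_mul_of_nonneg_left h (Real.exp_pos _).le).trans ?_
  rw [mul_left_comm, ← Real.exp_add]
  refine mul_le_of_le_one_right hn0.le (Real.exp_le_one_iff.2 ?_)
  have hsq : ((b - a) / 2) ^ 2 ≤ σ ^ 2 := pow_le_pow_left₀ (by linarith) hσr 2
  calc _ = (θ - m) ^ 2 / (2 * σ ^ 4) * (((b - a) / 2) ^ 2 - σ ^ 2) := by
        field_simp
        ring
    _ ≤ 0 := mul_nonpos_of_nonneg_of_nonpos (by positivity) (by linarith)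

/-- If `σ > r = (Yₙ - Y₁)/2`, then the Dirac measure at the sample mean
`Ȳ = n⁻¹ ∑ᵢ Yᵢ` maximizes the log-likelihood `G ↦ ∑ᵢ log (φ_σ ∗ G)(Yᵢ)` over `P(ℝ)`:
for every probability measure `G`, `∑ᵢ log (φ_σ ∗ G)(Yᵢ) ≤ ∑ᵢ log φ_σ(Yᵢ - Ȳ)`. -/
theorem npmle_single_atom_of_large_bandwidth
    (σ : ℝ) (hσ : 0 < σ)
    (n : ℕ) (hn : 1 ≤ n) (Y : Fin n → ℝ) (hY : Monotone Y)
    (hσr : (Y ⟨n - 1, by omega⟩ - Y ⟨0, by omega⟩) / 2 < σ) :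
    ∀ G : Measure ℝ, IsProbabilityMeasure G →
      ∑ i, Real.log (mix1 σ G (Y i)) ≤
        ∑ i, Real.log (gauss1 σ (Y i - (∑ j, Y j) / n)) := by
  intro G hG
  have hmin (i : Fin n) : Y ⟨0, by omega⟩ ≤ Y i := hY (Fin.le_def.2 (Nat.zero_le _))
  have hmax (i : Fin n) : Y i ≤ Y ⟨n - 1, by omega⟩ :=
    hY (Fin.le_def.2 (Nat.le_sub_one_of_lt i.isLt))
  have hgrad (θ : ℝ) := sum_gauss1_sub_div_le hσ hn (fun i => ⟨hmin i, hmax i⟩)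
    (hmin _) hσr.le θ
  generalize (∑ j, Y j) / (n : ℝ) = m at hgrad ⊢
  have hφ (i : Fin n) := gauss1_pos hσ (Y i - m)
  have hint (i : Fin n) : Integrable
      (fun θ => gauss1 σ (Y i - θ) / gauss1 σ (Y i - m)) G :=
    (integrable_gauss1_sub σ (Y i) G).div_const _
  have hmean : ∑ i, mix1 σ G (Y i) / gauss1 σ (Y i - m) ≤ n := by
    simp_rw [mix1, ← integral_div]
    rw [← integral_finsetSum _ fun i _ => hint i]
    calc _ ≤ ∫ _, (n : ℝ) ∂G := by
          refine integral_mono (integrable_finsetSum _ fun i _ => hint i)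
            (integrable_const _) fun θ => ?_
          exact hgrad θ
      _ = n := by simp
  rw [← sub_nonpos, ← Finset.sum_sub_distrib]
  calc _ ≤ ∑ i, (mix1 σ G (Y i) / gauss1 σ (Y i - m) - 1) := by
        refine Finset.sum_le_sum fun i _ => ?_
        have hmix := mix1_pos hσ (Y i) G
        rw [← Real.log_div hmix.ne' (hφ i).ne']
        exact Real.log_le_sub_one_of_pos (div_pos hmix (hφ i))
    _ ≤ 0 := by
        simpa [Finset.sum_sub_distrib] using hmean

end
end

section
/- Let δ > 0 and let I_δ = (2δ)^{-d} 𝟙_{[−δ,δ]^d} be the normalized box kernel on ℝ^d. Then for any θ, ω ∈ ℝ^d, ∫_{ℝ^d} |I_δ(x − θ) − I_δ(x − ω)| dx ≤ √d · δ^{-1} · |θ − ω|. -/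
open MeasureTheory Real

noncomputable section

/-- The normalized box kernel `I_δ = (2δ)^{-d} 𝟙_{[−δ,δ]^d}` on `ℝ^d`. -/
def boxKernel (d : ℕ) (δ : ℝ) (x : EuclideanSpace ℝ (Fin d)) : ℝ :=
  Set.indicator {y : EuclideanSpace ℝ (Fin d) | ∀ i, |y i| ≤ δ}
    (fun _ => ((2 * δ) ^ d)⁻¹) x

/-- The volume of an axis-parallel box in Euclidean space. -/
theorem volume_real_preimage_ofLp_Icc {ι : Type*} [Fintype ι] (a b : ι → ℝ) :
    (volume : Measure (EuclideanSpace ℝ ι)).real (WithLp.ofLp ⁻¹' Set.Icc a b) =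
      ∏ i, max (b i - a i) 0 := by
  rw [measureReal_def, (PiLp.volume_preserving_ofLp ι).measure_preimage
    measurableSet_Icc.nullMeasurableSet, Real.volume_Icc_pi, ENNReal.toReal_prod]
  simp [ENNReal.toReal_ofReal']

/-- The overlap of two cubes of half-width `δ` in Euclidean space, as a single box. -/
theorem volume_real_preimage_ofLp_Icc_inter {ι : Type*} [Fintype ι] (δ : ℝ) (a b : ι → ℝ) :
    (volume : Measure (EuclideanSpace ℝ ι)).real
      (WithLp.ofLp ⁻¹' Set.Icc (fun i => a i - δ) (fun i => a i + δ) ∩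
        WithLp.ofLp ⁻¹' Set.Icc (fun i => b i - δ) (fun i => b i + δ)) =
      ∏ i, max (2 * δ - |a i - b i|) 0 := by
  rw [← Set.preimage_inter, Set.Icc_inter_Icc, volume_real_preimage_ofLp_Icc]
  refine Finset.prod_congr rfl fun i _ => ?_
  simp only [Pi.sup_apply, Pi.inf_apply]
  congr 1
  rcases le_total (a i) (b i) with h | h
  · rw [inf_of_le_left (by linarith), sup_of_le_right (by linarith),
      abs_of_nonpos (by linarith)]
    ring
  · rw [inf_of_le_right (by linarith), sup_of_le_left (by linarith),
      abs_of_nonneg (by linarith)]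
    ring

theorem one_sub_prod_le_sum_one_sub {ι : Type*} (s : Finset ι) (f : ι → ℝ)
    (h0 : ∀ i, 0 ≤ f i) (h1 : ∀ i, f i ≤ 1) :
    1 - ∏ i ∈ s, f i ≤ ∑ i ∈ s, (1 - f i) := by
  classical
  induction s using Finset.induction_on with
  | empty => simp
  | insert a s ha ih =>
    rw [Finset.prod_insert ha, Finset.sum_insert ha]
    have hp : ∏ i ∈ s, f i ≤ 1 := Finset.prod_le_one (fun i _ => h0 i) fun i _ => h1 i
    nlinarith [mul_nonneg (sub_nonneg.2 (h1 a)) (sub_nonneg.2 hp)]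

theorem EuclideanSpace.sum_abs_le_sqrt_card_mul_norm {ι : Type*} [Fintype ι]
    (x : EuclideanSpace ℝ ι) : ∑ i, |x i| ≤ √(Fintype.card ι) * ‖x‖ := by
  rw [EuclideanSpace.norm_eq, ← Real.sqrt_mul (Nat.cast_nonneg _)]
  refine Real.le_sqrt_of_sq_le ?_
  simpa using sq_sum_le_card_mul_sum_sq (s := Finset.univ) (f := fun i => |x i|)

/-- The integral of the absolute difference of two scaled indicators. -/
theorem integral_abs_indicator_sub_indicator {α : Type*} [MeasurableSpace α] {μ : Measure α}
    {A B : Set α} (hA : MeasurableSet A) (hB : MeasurableSet B) (hμA : μ A ≠ ⊤) (hμB : μ B ≠ ⊤)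
    {c : ℝ} (hc : 0 ≤ c) :
    ∫ x, |A.indicator (fun _ => c) x - B.indicator (fun _ => c) x| ∂μ =
      c * (μ.real A + μ.real B - 2 * μ.real (A ∩ B)) := by
  have hμAB : μ (A ∩ B) ≠ ⊤ := measure_ne_top_of_subset Set.inter_subset_left hμA
  have key : ∀ x, |A.indicator (fun _ => c) x - B.indicator (fun _ => c) x| =
      A.indicator (fun _ => c) x + B.indicator (fun _ => c) x -
        2 * (A ∩ B).indicator (fun _ => c) x := by
    intro x
    by_cases h : x ∈ A <;> by_cases h' : x ∈ B <;> simp [h, h', abs_of_nonneg hc]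
    ring
  have iA : Integrable (A.indicator fun _ => c) μ :=
    (integrable_indicator_iff hA).2 (integrableOn_const hμA)
  have iB : Integrable (B.indicator fun _ => c) μ :=
    (integrable_indicator_iff hB).2 (integrableOn_const hμB)
  have iAB : Integrable ((A ∩ B).indicator fun _ => c) μ :=
    (integrable_indicator_iff (hA.inter hB)).2 (integrableOn_const hμAB)
  simp_rw [key]
  rw [integral_sub (by exact iA.add iB) (iAB.const_mul 2), integral_add iA iB, integral_const_mul,
    integral_indicator_const _ hA, integral_indicator_const _ hB,
    integral_indicator_const _ (hA.inter hB)]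
  simp only [smul_eq_mul]
  ring

theorem boxKernel_sub_eq_indicator (d : ℕ) (δ : ℝ) (x θ : EuclideanSpace ℝ (Fin d)) :
    boxKernel d δ (x - θ) =
      (WithLp.ofLp ⁻¹' Set.Icc (fun i => θ i - δ) (fun i => θ i + δ) :
        Set (EuclideanSpace ℝ (Fin d))).indicator (fun _ => ((2 * δ) ^ d)⁻¹) x := by
  unfold boxKernel
  refine Set.indicator_eq_indicator ?_ rfl
  simp only [Set.mem_ofPred_eq, Set.mem_preimage, Set.mem_Icc, Pi.le_def, ← forall_and,
    PiLp.sub_apply, abs_le]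
  refine forall_congr' fun i => ?_
  constructor <;> rintro ⟨h, h'⟩ <;> constructor <;> linarith

/-- For the box kernel `I_δ` and any `θ, ω ∈ ℝ^d`,
`∫ |I_δ(x − θ) − I_δ(x − ω)| dx ≤ √d · δ⁻¹ · |θ − ω|`. -/
theorem box_kernel_translation_L1_bound
    (d : ℕ) (δ : ℝ) (hδ : 0 < δ) (θ ω : EuclideanSpace ℝ (Fin d)) :
    ∫ x, |boxKernel d δ (x - θ) - boxKernel d δ (x - ω)| ≤
      Real.sqrt d * δ⁻¹ * ‖θ - ω‖ := by
  have hvol : ∀ η : EuclideanSpace ℝ (Fin d), (volume : Measure (EuclideanSpace ℝ (Fin d))).real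
      (WithLp.ofLp ⁻¹' Set.Icc (fun i => η i - δ) (fun i => η i + δ)) = (2 * δ) ^ d := by
    intro η
    simpa [hδ.le] using volume_real_preimage_ofLp_Icc_inter δ η.ofLp η.ofLp
  have hmeas : ∀ η : EuclideanSpace ℝ (Fin d), MeasurableSet
      (WithLp.ofLp ⁻¹' Set.Icc (fun i => η i - δ) (fun i => η i + δ) :
        Set (EuclideanSpace ℝ (Fin d))) := fun η =>
    (PiLp.volume_preserving_ofLp (Fin d)).measurable measurableSet_Icc
  have hfin : ∀ η : EuclideanSpace ℝ (Fin d), (volume : Measure (EuclideanSpace ℝ (Fin d)))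
      (WithLp.ofLp ⁻¹' Set.Icc (fun i => η i - δ) (fun i => η i + δ)) ≠ ⊤ := by
    intro η
    rw [(PiLp.volume_preserving_ofLp (Fin d)).measure_preimage
      measurableSet_Icc.nullMeasurableSet]
    exact isCompact_Icc.measure_ne_top
  simp_rw [boxKernel_sub_eq_indicator]
  rw [integral_abs_indicator_sub_indicator (hmeas θ) (hmeas ω) (hfin θ) (hfin ω)
    (by positivity), hvol, hvol, volume_real_preimage_ofLp_Icc_inter]
  set f : Fin d → ℝ := fun i => max (1 - |θ i - ω i| / (2 * δ)) 0 with hf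
  have hprod : ∏ i, max (2 * δ - |θ i - ω i|) 0 = (2 * δ) ^ d * ∏ i, f i := by
    have hconst : (2 * δ) ^ d = ∏ _i : Fin d, (2 * δ) := by simp
    rw [hconst, ← Finset.prod_mul_distrib]
    refine Finset.prod_congr rfl fun i _ => ?_
    rw [hf, mul_max_of_nonneg _ _ (by positivity), mul_zero]
    congr 1
    field_simp
  have hsum : 1 - ∏ i, f i ≤ ∑ i, (1 - f i) := by
    refine one_sub_prod_le_sum_one_sub _ f (fun i => le_max_right _ _) fun i => ?_
    exact max_le (sub_le_self _ (by positivity)) zero_le_one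
  have hsum' : ∑ i, (1 - f i) ≤ ∑ i, |(θ - ω) i| / (2 * δ) := by
    refine Finset.sum_le_sum fun i _ => ?_
    rw [PiLp.sub_apply, sub_le_comm]
    exact le_max_left _ _
  have hcs := EuclideanSpace.sum_abs_le_sqrt_card_mul_norm (θ - ω)
  rw [Fintype.card_fin] at hcs
  rw [← Finset.sum_div] at hsum'
  calc ((2 * δ) ^ d)⁻¹ * ((2 * δ) ^ d + (2 * δ) ^ d - 2 * ∏ i, max (2 * δ - |θ i - ω i|) 0)
      = 2 * (1 - ∏ i, f i) := by
        rw [hprod]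
        field_simp
        ring
    _ ≤ 2 * ((∑ i, |(θ - ω) i|) / (2 * δ)) := by linarith
    _ = δ⁻¹ * ∑ i, |(θ - ω) i| := by field_simp
    _ ≤ δ⁻¹ * (√d * ‖θ - ω‖) := by gcongr
    _ = √d * δ⁻¹ * ‖θ - ω‖ := by ring

end
end
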